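/- Let G be the unidirectional ring on k vertices, with edge set {(i, i+1) : 1 ≤ i ≤ k−1} ∪ {(k, 1)}. Suppose A_1, …, A_r are stable and A_{r+1}, …, A_k are unstable (1 ≤ r < k). Let ρ = Π_{(i,j)∈E(G)} ‖P_j⁻¹P_i‖ and β = −(Σ_{i=1}^{r} λ_i)·τ + (Σ_{j=r+1}^{k} μ_j)·η. If ln ρ + β < 0, then the switched system is asymptotically stable for every signal σ ∈ S_G(τ, η). -/

import Mathlib

open Matrix Filter Topology Finset

attribute [local instance] Classical.propDecidable

noncomputable section

/-- The spectral (ℓ² operator) norm of a complex square matrix. -/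
def sNorm {n : ℕ} (M : Matrix (Fin n) (Fin n) ℂ) : ℝ :=
  ‖Matrix.toEuclideanCLM (𝕜 := ℂ) M‖

/-- The spectral (ℓ² operator) norm of a real square matrix. -/
def sNormR {n : ℕ} (M : Matrix (Fin n) (Fin n) ℝ) : ℝ :=
  ‖Matrix.toEuclideanCLM (𝕜 := ℝ) M‖

/-- The ordered product `exp(A_{σ_m}(t_m - t_{m-1})) ⋯ exp(A_{σ_1} t_1)` of the switched
system (0-based: `flow A t v m = exp((t m - t (m-1)) • A (v (m-1))) * ⋯ * exp((t 1 - t 0) • A (v 0))`). -/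
def flow {n k : ℕ} (A : Fin k → Matrix (Fin n) (Fin n) ℝ)
    (t : ℕ → ℝ) (v : ℕ → Fin k) : ℕ → Matrix (Fin n) (Fin n) ℝ
  | 0 => 1
  | m + 1 => NormedSpace.exp ((t (m + 1) - t m) • A (v m)) * flow A t v m

/-- Piecewise evaluation: the value `f m` on the interval `[t m, t (m+1))`. -/
def pc {α : Type*} (t : ℕ → ℝ) (f : ℕ → α) (d : α) (s : ℝ) : α :=
  if h : ∃ m, t m ≤ s ∧ s < t (m + 1) then f h.choose else d

/-- The solution of the switched system `x' = A_{σ(t)} x`, `x(0) = x0`: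
for `s ∈ [t m, t (m+1))`, `x(s) = exp((s - t m) • A (v m)) * flow A t v m * x0`. -/
def sol {n k : ℕ} (A : Fin k → Matrix (Fin n) (Fin n) ℝ)
    (t : ℕ → ℝ) (v : ℕ → Fin k) (x0 : EuclideanSpace ℝ (Fin n)) (s : ℝ) :
    EuclideanSpace ℝ (Fin n) :=
  pc t (fun m => Matrix.toEuclideanCLM (𝕜 := ℝ)
    (NormedSpace.exp ((s - t m) • A (v m)) * flow A t v m) x0) 0 s

/-- A `G`-admissible switching signal: `t 0 = 0`, strictly increasing switching times tending
to infinity, and consecutive vertices joined by edges of `G`.  Here `v m` is the vertex active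
on `[t m, t (m+1))` (i.e. `v m = σ_{m+1}` in 1-based notation). -/
def Admissible {k : ℕ} (E : Set (Fin k × Fin k)) (t : ℕ → ℝ) (v : ℕ → Fin k) : Prop :=
  t 0 = 0 ∧ StrictMono t ∧ Tendsto t atTop atTop ∧ ∀ m, (v m, v (m + 1)) ∈ E

/-- A real matrix is stable if all its (complex) eigenvalues have negative real part. -/
def MStable {n : ℕ} (M : Matrix (Fin n) (Fin n) ℝ) : Prop :=
  ∀ z ∈ spectrum ℂ (M.map (Complex.ofReal)), z.re < 0

/-- A real matrix is unstable if some eigenvalue has positive real part and no eigenvalue has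
zero real part. -/
def MUnstable {n : ℕ} (M : Matrix (Fin n) (Fin n) ℝ) : Prop :=
  (∃ z ∈ spectrum ℂ (M.map (Complex.ofReal)), 0 < z.re) ∧
    ∀ z ∈ spectrum ℂ (M.map (Complex.ofReal)), z.re ≠ 0

/-- `a` is the maximum of the real parts of the eigenvalues of `M`. -/
def MaxRe {n : ℕ} (M : Matrix (Fin n) (Fin n) ℝ) (a : ℝ) : Prop :=
  IsGreatest (Complex.re '' spectrum ℂ (M.map (Complex.ofReal))) a

/-- `M = P D P⁻¹` with `P` invertible and `D` diagonal (diagonalizability over `ℂ`). -/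
def Diagonalized {n : ℕ} (M : Matrix (Fin n) (Fin n) ℝ)
    (P D : Matrix (Fin n) (Fin n) ℂ) : Prop :=
  IsUnit P ∧ D.IsDiag ∧ M.map (Complex.ofReal) = P * D * P⁻¹

/-- Asymptotic stability of the switched system for the given signal. -/
def AsympStable {n k : ℕ} (A : Fin k → Matrix (Fin n) (Fin n) ℝ)
    (t : ℕ → ℝ) (v : ℕ → Fin k) : Prop :=
  ∀ x0 : EuclideanSpace ℝ (Fin n), Tendsto (fun s => ‖sol A t v x0 s‖) atTop (𝓝 0)

/-- Membership in the class `S_G(τ, η)`: dwell time at least `τ` in the stable subsystems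
(indices `< r`), flee time at most `η` in the unstable subsystems (indices `≥ r`). -/
def InSG {k : ℕ} (r : ℕ) (τ η : ℝ) (t : ℕ → ℝ) (v : ℕ → Fin k) : Prop :=
  ∀ m, ((v m).1 < r → τ ≤ t (m + 1) - t m) ∧ (r ≤ (v m).1 → t (m + 1) - t m ≤ η)

end

lemma sNorm_mul_le {n : ℕ} (M N : Matrix (Fin n) (Fin n) ℂ) :
    sNorm (M * N) ≤ sNorm M * sNorm N := by
  unfold sNorm
  rw [map_mul]
  exact norm_mul_le _ _

lemma sNorm_nonneg {n : ℕ} (M : Matrix (Fin n) (Fin n) ℂ) : 0 ≤ sNorm M := norm_nonneg _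

lemma sNorm_pos {n : ℕ} (hn : 0 < n) (M : Matrix (Fin n) (Fin n) ℂ) (hM : IsUnit M) :
    0 < sNorm M := by
  haveI : Nonempty (Fin n) := ⟨⟨0, hn⟩⟩
  unfold sNorm
  rw [norm_pos_iff]
  intro h
  have h0 : M = 0 := by
    exact (EmbeddingLike.map_eq_zero_iff (f := Matrix.toEuclideanCLM (n := Fin n) (𝕜 := ℂ))).1 h
  rw [h0] at hM
  exact not_isUnit_zero hM

lemma norm_real_le {n : ℕ} (M : Matrix (Fin n) (Fin n) ℝ) (x : EuclideanSpace ℝ (Fin n)) :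
    ‖Matrix.toEuclideanCLM (𝕜 := ℝ) M x‖ ≤ sNorm (M.map Complex.ofReal) * ‖x‖ := by
  have h2 : ‖(WithLp.toLp 2 (fun i => (x i : ℂ)) : EuclideanSpace ℂ (Fin n))‖ = ‖x‖ := by
    simp [EuclideanSpace.norm_eq]
  have h1 : ‖Matrix.toEuclideanCLM (𝕜 := ℂ) (M.map Complex.ofReal)
      (WithLp.toLp 2 (fun i => (x i : ℂ)) : EuclideanSpace ℂ (Fin n))‖
      = ‖Matrix.toEuclideanCLM (𝕜 := ℝ) M x‖ := by
    rw [EuclideanSpace.norm_eq, EuclideanSpace.norm_eq]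
    congr 1
    apply Finset.sum_congr rfl
    intro i _
    simp only [Matrix.ofLp_toEuclideanCLM, Matrix.mulVec, dotProduct, Matrix.map_apply]
    have : (∑ j, (M i j : ℂ) * (x j : ℂ)) = ((∑ j, M i j * x j : ℝ) : ℂ) := by push_cast; rfl
    rw [this, Complex.norm_real]
  rw [← h1, ← h2]
  exact ContinuousLinearMap.le_opNorm _ _

open scoped Matrix.Norms.Operator in
lemma exp_map_ofReal {n : ℕ} (M : Matrix (Fin n) (Fin n) ℝ) :
    (NormedSpace.exp M).map Complex.ofReal = NormedSpace.exp (M.map Complex.ofReal) := by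
  have hc : Continuous (Complex.ofRealHom.mapMatrix :
      Matrix (Fin n) (Fin n) ℝ →+* Matrix (Fin n) (Fin n) ℂ) :=
    Continuous.matrix_map continuous_id Complex.continuous_ofReal
  exact NormedSpace.map_exp (Complex.ofRealHom.mapMatrix :
      Matrix (Fin n) (Fin n) ℝ →+* Matrix (Fin n) (Fin n) ℂ) hc M

open scoped Matrix.Norms.L2Operator in
lemma sNorm_diag {n : ℕ} (w : Fin n → ℂ) : sNorm (Matrix.diagonal w) = ‖w‖ :=
  Matrix.l2_opNorm_diagonal w

lemma exp_diagd {n : ℕ} {M : Matrix (Fin n) (Fin n) ℝ} {P D : Matrix (Fin n) (Fin n) ℂ}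
    (h : Diagonalized M P D) {a : ℝ} (ha : MaxRe M a) :
    ∀ s : ℝ, 0 ≤ s → ∃ E : Matrix (Fin n) (Fin n) ℂ,
      (NormedSpace.exp (s • M)).map Complex.ofReal = P * E * P⁻¹ ∧ sNorm E ≤ Real.exp (a * s) := by
  intro s hs
  obtain ⟨hP, hD, hM⟩ := h
  refine ⟨NormedSpace.exp ((s : ℂ) • D), ?_, ?_⟩
  · rw [exp_map_ofReal, ← Matrix.exp_conj _ _ hP]
    congr 1
    have : (s • M).map Complex.ofReal = (s : ℂ) • M.map Complex.ofReal := by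
      ext i j; simp
    rw [this, hM]
    simp
  · have hDd : D = Matrix.diagonal (fun i => D i i) := by
      exact ((Matrix.isDiag_iff_diagonal_diag D).1 hD).symm
    have hre : ∀ i, (D i i).re ≤ a := by
      intro i
      apply ha.2
      refine ⟨D i i, ?_, rfl⟩
      have hinv : P⁻¹ = ((hP.unit⁻¹ : (Matrix (Fin n) (Fin n) ℂ)ˣ) : Matrix (Fin n) (Fin n) ℂ) := by
        rw [Matrix.coe_units_inv]; rfl
      have hsp : spectrum ℂ (M.map Complex.ofReal) = spectrum ℂ D := by
        rw [hM, hinv]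
        exact spectrum.units_conjugate (u := hP.unit)
      rw [hsp, hDd, spectrum_diagonal]
      exact ⟨i, by simp⟩
    have h1 : (s : ℂ) • D = Matrix.diagonal (fun i => (s : ℂ) * D i i) := by
      conv_lhs => rw [hDd]
      ext i j
      simp [Matrix.diagonal_apply]
    rw [h1, Matrix.exp_diagonal, sNorm_diag, pi_norm_le_iff_of_nonneg (Real.exp_pos _).le]
    intro i
    rw [Pi.coe_exp, ← Complex.exp_eq_exp_ℂ, Complex.norm_exp, Real.exp_le_exp]
    simp only [Complex.mul_re, Complex.ofReal_re, Complex.ofReal_im, zero_mul, sub_zero]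
    nlinarith [hre i]

/-- A nonnegative sequence contracted by a factor `q < 1` every `k` steps tends to zero. -/
lemma tendsto_of_contract {k : ℕ} (hk : 0 < k) (w : ℕ → ℝ) (hw : ∀ m, 0 ≤ w m) (q : ℝ)
    (hq0 : 0 ≤ q) (hq : q < 1) (h : ∀ m, w (m + k) ≤ q * w m) :
    Tendsto w atTop (𝓝 0) := by
  have h1 : ∀ a j, w (j + k * a) ≤ q ^ a * w j := by
    intro a
    induction a with
    | zero => intro j; simp
    | succ a ih =>
      intro j
      calc w (j + k * (a + 1)) = w (j + k * a + k) := by ring_nf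
        _ ≤ q * w (j + k * a) := h _
        _ ≤ q * (q ^ a * w j) := mul_le_mul_of_nonneg_left (ih j) hq0
        _ = _ := by ring
  have h2 : ∀ m, w m ≤ q ^ (m / k) * ∑ j ∈ Finset.range k, w j := by
    intro m
    calc w m = w (m % k + k * (m / k)) := by rw [Nat.mod_add_div]
      _ ≤ q ^ (m / k) * w (m % k) := h1 _ _
      _ ≤ _ := by
        apply mul_le_mul_of_nonneg_left _ (pow_nonneg hq0 _)
        exact Finset.single_le_sum (f := w) (fun i _ => hw i)
          (Finset.mem_range.2 (Nat.mod_lt _ hk))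
  have h3 : Tendsto (fun m : ℕ => q ^ (m / k) * ∑ j ∈ Finset.range k, w j) atTop (𝓝 0) := by
    have := ((tendsto_pow_atTop_nhds_zero_of_lt_one hq0 hq).comp
      (Nat.tendsto_div_const_atTop hk.ne')).mul_const (∑ j ∈ Finset.range k, w j)
    simpa using this
  exact squeeze_zero hw h2 h3

lemma prod_ring {k : ℕ} [NeZero k] (v : ℕ → Fin k) (hv : ∀ m, v (m + 1) = v m + 1)
    (g : Fin k → ℝ) (m : ℕ) : ∏ j ∈ Finset.range k, g (v (m + j)) = ∏ i, g i := by
  have h1 : ∀ j, v (m + j) = v m + Fin.ofNat k j := by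
    intro j
    induction j with
    | zero => 
      have : Fin.ofNat k 0 = 0 := rfl
      rw [this]; simp
    | succ j ih =>
      rw [← add_assoc, hv, ih, add_assoc]
      congr 1
      apply Fin.ext
      simp [Fin.val_add]
  rw [Finset.prod_range, ← Equiv.prod_comp (Equiv.addLeft (v m)) g]
  apply Finset.prod_congr rfl
  intro j _
  rw [h1]
  congr 1
  simp only [Equiv.coe_addLeft]
  congr 1
  apply Fin.ext
  simp [Nat.mod_eq_of_lt j.2]


/-- unidirectional ring: vertices `0,…,k-1` (1-based `1,…,k`), edges
`i → i+1 (mod k)`; subsystems with index `< r` stable, the rest unstable.  If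
`ln ρ + β < 0` with `ρ = Π_{edges} ‖P_{i+1}⁻¹P_i‖` and
`β = −(Σ_{stable} λ_i)τ + (Σ_{unstable} μ_j)η`, then the switched system is asymptotically
stable for every signal in `S_G(τ, η)`. -/
theorem ring_stability_dwell_flee {n k : ℕ} [NeZero k] (r : ℕ) (hr : 1 ≤ r) (hrk : r < k)
    (A : Fin k → Matrix (Fin n) (Fin n) ℝ) (P D : Fin k → Matrix (Fin n) (Fin n) ℂ)
    (hdiag : ∀ i, Diagonalized (A i) (P i) (D i))
    (hstab : ∀ i : Fin k, i.1 < r → MStable (A i))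
    (hunst : ∀ i : Fin k, r ≤ i.1 → MUnstable (A i))
    (lam mu : Fin k → ℝ)
    (hlam : ∀ i : Fin k, i.1 < r → MaxRe (A i) (-(lam i)))
    (hmu : ∀ i : Fin k, r ≤ i.1 → MaxRe (A i) (mu i))
    (τ η : ℝ) (hτ : 0 < τ) (hη : 0 < η)
    (hcond : Real.log (∏ i : Fin k, sNorm ((P (i + 1))⁻¹ * P i)) +
        (-(∑ i ∈ Finset.univ.filter (fun i : Fin k => i.1 < r), lam i) * τ +
          (∑ i ∈ Finset.univ.filter (fun i : Fin k => r ≤ i.1), mu i) * η) < 0)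
    (t : ℕ → ℝ) (v : ℕ → Fin k)
    (hadm : Admissible {e : Fin k × Fin k | e.2 = e.1 + 1} t v)
    (hsg : InSG r τ η t v) :
    AsympStable A t v := by
  obtain ⟨ht0, htm, htt, hv⟩ := hadm
  have hv' : ∀ m, v (m + 1) = v m + 1 := fun m => hv m
  have hk : 0 < k := by omega
  -- positivity of the dimension
  have hn : 0 < n := by
    rcases Nat.eq_zero_or_pos n with h | h
    · subst h
      obtain ⟨z, hz, -⟩ := (hlam ⟨0, hk⟩ hr).1
      exfalso
      apply hz
      haveI : Subsingleton (Matrix (Fin 0) (Fin 0) ℂ) := inferInstance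
      exact isUnit_of_subsingleton _
    · exact h
  set d : Fin k → ℝ := fun i => if i.1 < r then -(lam i) else mu i with hd
  set T : Fin k → ℝ := fun i => if i.1 < r then τ else η with hT
  have hmax : ∀ i, MaxRe (A i) (d i) := by
    intro i
    by_cases h : i.1 < r
    · simp only [hd, h, if_true]; exact hlam i h
    · simp only [hd, h, if_false]; exact hmu i (not_lt.1 h)
  have hdneg : ∀ i : Fin k, i.1 < r → d i < 0 := by
    intro i h
    obtain ⟨z, hz, hz'⟩ := (hmax i).1
    rw [← hz']; exact hstab i h z hz
  have hdpos : ∀ i : Fin k, ¬ i.1 < r → 0 < d i := by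
    intro i h
    obtain ⟨z, hz, hz'⟩ := (hunst i (not_lt.1 h)).1
    exact lt_of_lt_of_le hz' ((hmax i).2 ⟨z, hz, rfl⟩)
  have hdt : ∀ m, 0 < t (m + 1) - t m := fun m => sub_pos.2 (htm (Nat.lt_succ_self m))
  have hdT : ∀ m, d (v m) * (t (m + 1) - t m) ≤ d (v m) * T (v m) := by
    intro m
    by_cases h : (v m).1 < r
    · have h1 := (hsg m).1 h
      have h2 := hdneg _ h
      have h3 : T (v m) = τ := by simp [hT, h]
      rw [h3]; nlinarith
    · have h1 := (hsg m).2 (not_lt.1 h)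
      have h2 := hdpos _ h
      have h3 : T (v m) = η := by simp [hT, h]
      rw [h3]; nlinarith
  set c : Fin k → ℝ := fun i => sNorm ((P (i + 1))⁻¹ * P i) with hc
  set g : Fin k → ℝ := fun i => c i * Real.exp (d i * T i) with hg
  have hcpos : ∀ i, 0 < c i := by
    intro i
    apply sNorm_pos hn
    exact ((Matrix.isUnit_nonsing_inv_iff).2 (hdiag (i + 1)).1).mul (hdiag i).1
  have hg0 : ∀ i, 0 ≤ g i := fun i => mul_nonneg (hcpos i).le (Real.exp_pos _).le
  have hsum : ∑ i, d i * T i =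
      -(∑ i ∈ Finset.univ.filter (fun i : Fin k => i.1 < r), lam i) * τ +
          (∑ i ∈ Finset.univ.filter (fun i : Fin k => r ≤ i.1), mu i) * η := by
    rw [neg_mul, Finset.sum_mul, Finset.sum_mul, Finset.sum_filter, Finset.sum_filter,
      ← Finset.sum_neg_distrib, ← Finset.sum_add_distrib]
    apply Finset.sum_congr rfl
    intro i _
    by_cases h : i.1 < r
    · have h' : ¬ r ≤ i.1 := not_le.2 h
      simp [hd, hT, h, h']
    · have h' : r ≤ i.1 := not_lt.1 h
      simp [hd, hT, h, h']
  have hq : ∏ i, g i < 1 := by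
    have h1 : ∏ i, g i = (∏ i, c i) * Real.exp (∑ i, d i * T i) := by
      rw [Real.exp_sum, ← Finset.prod_mul_distrib]
    have h2 : 0 < ∏ i, c i := Finset.prod_pos (fun i _ => hcpos i)
    rw [h1]
    nth_rw 1 [← Real.exp_log h2]
    rw [← Real.exp_add, Real.exp_lt_one_iff, hsum]
    exact hcond
  set w : ℕ → ℝ := fun m => sNorm ((P (v m))⁻¹ * (flow A t v m).map Complex.ofReal) with hw
  have hw0 : ∀ m, 0 ≤ w m := fun m => sNorm_nonneg _
  have hmapmul : ∀ M N : Matrix (Fin n) (Fin n) ℝ, (M * N).map Complex.ofReal =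
      M.map Complex.ofReal * N.map Complex.ofReal := fun M N =>
    map_mul (Complex.ofRealHom.mapMatrix :
      Matrix (Fin n) (Fin n) ℝ →+* Matrix (Fin n) (Fin n) ℂ) M N
  have hstep : ∀ m, w (m + 1) ≤ g (v m) * w m := by
    intro m
    obtain ⟨E, hE, hEn⟩ := exp_diagd (hdiag (v m)) (hmax (v m)) _ (hdt m).le
    have h1 : (P (v (m + 1)))⁻¹ * (flow A t v (m + 1)).map Complex.ofReal =
        ((P (v m + 1))⁻¹ * P (v m)) * (E * ((P (v m))⁻¹ * (flow A t v m).map Complex.ofReal)) := by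
      rw [flow, hmapmul, hE, hv']
      simp only [Matrix.mul_assoc]
    calc w (m + 1) = sNorm (((P (v m + 1))⁻¹ * P (v m)) *
          (E * ((P (v m))⁻¹ * (flow A t v m).map Complex.ofReal))) := by rw [hw]; simp only [h1]
      _ ≤ c (v m) * (sNorm E * w m) := (sNorm_mul_le _ _).trans
          (mul_le_mul_of_nonneg_left (sNorm_mul_le _ _) (hcpos _).le)
      _ ≤ c (v m) * (Real.exp (d (v m) * T (v m)) * w m) := by
          apply mul_le_mul_of_nonneg_left _ (hcpos _).le
          apply mul_le_mul_of_nonneg_right _ (hw0 m)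
          exact hEn.trans (Real.exp_le_exp.2 (hdT m))
      _ = g (v m) * w m := by rw [hg]; ring
  have hmulti : ∀ m j, w (m + j) ≤ (∏ l ∈ Finset.range j, g (v (m + l))) * w m := by
    intro m j
    induction j with
    | zero => simp
    | succ j ih =>
      rw [Finset.prod_range_succ]
      calc w (m + (j + 1)) ≤ g (v (m + j)) * w (m + j) := hstep (m + j)
        _ ≤ g (v (m + j)) * ((∏ l ∈ Finset.range j, g (v (m + l))) * w m) :=
          mul_le_mul_of_nonneg_left ih (hg0 _)
        _ = _ := by ring
  have hwt : Tendsto w atTop (𝓝 0) := by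
    refine tendsto_of_contract hk w hw0 (∏ i, g i) (Finset.prod_nonneg fun i _ => hg0 i) hq ?_
    intro m
    have := hmulti m k
    rwa [prod_ring v hv' g m] at this
  -- bound between switching times
  set K : ℝ := ∑ i, sNorm (P i) * Real.exp (|d i| * η) with hK
  have hK0 : 0 ≤ K := Finset.sum_nonneg fun i _ =>
    mul_nonneg (sNorm_nonneg _) (Real.exp_pos _).le
  intro x0
  have hbd : ∀ m s, t m ≤ s → s < t (m + 1) →
      ‖Matrix.toEuclideanCLM (𝕜 := ℝ)
        (NormedSpace.exp ((s - t m) • A (v m)) * flow A t v m) x0‖ ≤ K * w m * ‖x0‖ := by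
    intro m s hs1 hs2
    obtain ⟨E, hE, hEn⟩ := exp_diagd (hdiag (v m)) (hmax (v m)) (s - t m) (sub_nonneg.2 hs1)
    refine (norm_real_le _ _).trans (mul_le_mul_of_nonneg_right ?_ (norm_nonneg _))
    rw [hmapmul, hE, Matrix.mul_assoc, Matrix.mul_assoc]
    have hexp : d (v m) * (s - t m) ≤ |d (v m)| * η := by
      by_cases h : (v m).1 < r
      · have h2 := hdneg _ h
        have h3 : 0 ≤ |d (v m)| * η := mul_nonneg (abs_nonneg _) hη.le
        nlinarith
      · have h1 := (hsg m).2 (not_lt.1 h)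
        have h2 := hdpos _ h
        rw [abs_of_pos h2]
        nlinarith
    calc _ ≤ sNorm (P (v m)) * (sNorm E * w m) := (sNorm_mul_le _ _).trans
          (mul_le_mul_of_nonneg_left (sNorm_mul_le _ _) (sNorm_nonneg _))
      _ ≤ sNorm (P (v m)) * (Real.exp (|d (v m)| * η) * w m) := by
          apply mul_le_mul_of_nonneg_left _ (sNorm_nonneg _)
          apply mul_le_mul_of_nonneg_right _ (hw0 m)
          exact hEn.trans (Real.exp_le_exp.2 hexp)
      _ = (sNorm (P (v m)) * Real.exp (|d (v m)| * η)) * w m := by ring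
      _ ≤ K * w m := by
          apply mul_le_mul_of_nonneg_right _ (hw0 m)
          exact Finset.single_le_sum (f := fun i => sNorm (P i) * Real.exp (|d i| * η))
            (fun i _ => mul_nonneg (sNorm_nonneg _) (Real.exp_pos _).le) (Finset.mem_univ (v m))
  have hlim : Tendsto (fun m => K * w m * ‖x0‖) atTop (𝓝 0) := by
    have := (hwt.const_mul K).mul_const ‖x0‖
    simpa using this
  rw [Metric.tendsto_atTop]
  intro ε hε
  obtain ⟨N, hN⟩ := eventually_atTop.1 (hlim.eventually (gt_mem_nhds hε))
  refine ⟨t N, fun s hs => ?_⟩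
  rw [dist_zero_right, norm_norm]
  unfold sol pc
  split_ifs with h
  · obtain ⟨h1, h2⟩ := h.choose_spec
    have hlt : N < h.choose + 1 := htm.lt_iff_lt.1 (lt_of_le_of_lt hs h2)
    exact lt_of_le_of_lt (hbd _ s h1 h2) (hN _ (by omega))
  · simpa using hε
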